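/- Let p be an odd prime and n ≥ 0 an integer. For every x ∈ ℂ_p with |x| ≤ p^{n - 1/(p-1)} there exists t ∈ ℂ_p with |t - 1| ≤ p^{-1/(p^{n-1}(p-1))} such that log_p(t) = x · log_p(1+p). -/

import Mathlib

open Filter Topology

/-- The `p`-adic logarithm, given by the series
`log_p(t) = ∑_{k ≥ 1} (-1)^(k+1) (t-1)^k / k` (convergent for `‖t - 1‖ < 1`). -/
noncomputable def plog {K : Type*} [NormedField K] (t : K) : K :=
  ∑' k : ℕ, (-1) ^ k * (t - 1) ^ (k + 1) / ((k + 1 : ℕ) : K)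

section helpers

variable {p : ℕ} [Fact p.Prime] {K : Type*} [NormedField K] [Algebra ℚ_[p] K]

lemma nat_norm_eq (hnorm : ∀ x : ℚ_[p], ‖(algebraMap ℚ_[p] K) x‖ = ‖x‖) (k : ℕ) :
    ‖(k : K)‖ = ‖(k : ℚ_[p])‖ := by
  rw [← hnorm, map_natCast]

lemma p_norm_eq (hnorm : ∀ x : ℚ_[p], ‖(algebraMap ℚ_[p] K) x‖ = ‖x‖) :
    ‖(p : K)‖ = (p : ℝ)⁻¹ := by
  rw [nat_norm_eq hnorm, Padic.norm_p]

lemma nat_norm_le_one (hnorm : ∀ x : ℚ_[p], ‖(algebraMap ℚ_[p] K) x‖ = ‖x‖) (k : ℕ) :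
    ‖(k : K)‖ ≤ 1 := by
  rw [nat_norm_eq hnorm]
  exact_mod_cast Padic.norm_int_le_one (p := p) (k : ℤ)

lemma nat_norm_inv (hnorm : ∀ x : ℚ_[p], ‖(algebraMap ℚ_[p] K) x‖ = ‖x‖) (k : ℕ) (hk : k ≠ 0) :
    ‖(k : K)‖⁻¹ = (p : ℝ) ^ (padicValNat p k) := by
  rw [nat_norm_eq hnorm, Padic.norm_eq_zpow_neg_valuation (by exact_mod_cast hk),
    Padic.valuation_natCast, zpow_neg, inv_inv, zpow_natCast]

lemma nat_norm_inv_le (hnorm : ∀ x : ℚ_[p], ‖(algebraMap ℚ_[p] K) x‖ = ‖x‖) (k : ℕ)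
    (hk : k ≠ 0) : ‖(k : K)‖⁻¹ ≤ k := by
  rw [nat_norm_inv hnorm k hk]
  exact_mod_cast Nat.le_of_dvd (Nat.pos_of_ne_zero hk) pow_padicValNat_dvd

lemma val_bound (hodd : Odd p) (k : ℕ) : padicValNat p (k + 2) ≤ k := by
  have hp : p.Prime := Fact.out
  have h3 : 3 ≤ p := by
    have := hp.two_le
    rcases hodd with ⟨m, hm⟩
    omega
  have h1 : p ^ padicValNat p (k + 2) ≤ k + 2 := Nat.le_of_dvd (by omega) pow_padicValNat_dvd
  have h2 : 3 ^ padicValNat p (k + 2) ≤ k + 2 := (Nat.pow_le_pow_left h3 _).trans h1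
  generalize padicValNat p (k + 2) = v at h2
  rcases v with _ | v
  · omega
  have h4 : v < 3 ^ v := Nat.lt_pow_self (by norm_num)
  rw [pow_succ] at h2
  omega

lemma val_bound' (k : ℕ) : padicValNat p (k + 1) ≤ k := by
  have hp : p.Prime := Fact.out
  have h1 : p ^ padicValNat p (k + 1) ≤ k + 1 := Nat.le_of_dvd (by omega) pow_padicValNat_dvd
  have h4 : padicValNat p (k + 1) < p ^ padicValNat p (k + 1) := Nat.lt_pow_self hp.one_lt
  omega

lemma us_sub {L : Type*} [NormedField L] [IsUltrametricDist L] (a b : L) :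
    ‖a - b‖ ≤ max ‖a‖ ‖b‖ := by
  rw [sub_eq_add_neg, ← norm_neg b]
  exact IsUltrametricDist.norm_add_le_max _ _

lemma root_bound [IsUltrametricDist K]
    (hnorm : ∀ x : ℚ_[p], ‖(algebraMap ℚ_[p] K) x‖ = ‖x‖) (a : ℝ) (ha0 : 0 ≤ a)
    (ha : (p : ℝ)⁻¹ ≤ a ^ (p - 1)) (t : K) (ht : ‖t ^ p - 1‖ ≤ a ^ p) : ‖t - 1‖ ≤ a := by
  have hp : p.Prime := Fact.out
  have hp2 := hp.two_le
  by_contra! hlt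
  set u := t - 1 with hu
  have hu0 : 0 < ‖u‖ := ha0.trans_lt hlt
  have hpp : (p : ℝ)⁻¹ < ‖u‖ ^ (p - 1) :=
    ha.trans_lt (pow_lt_pow_left₀ hlt ha0 (by omega))
  have hpu : (p : ℝ)⁻¹ < ‖u‖ := by
    rcases le_total ‖u‖ 1 with h | h
    · exact hpp.trans_le (pow_le_of_le_one hu0.le h (by omega))
    · refine lt_of_lt_of_le (inv_lt_one_of_one_lt₀ (by exact_mod_cast hp.one_lt)) h
  have hpow : ‖u‖ ^ p = ‖u‖ ^ (p - 1) * ‖u‖ := by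
    rw [← pow_succ]; congr 1; omega
  have key := add_pow_prime_eq hp u 1
  have htu : u + 1 = t := by rw [hu]; ring
  rw [htu, one_pow, mul_one, mul_assoc] at key
  set S := u * ∑ k ∈ Finset.Ioo 0 p, u ^ (k - 1) * 1 ^ (p - k - 1) * ((p.choose k / p : ℕ) : K) with hS
  have hSn : ‖S‖ ≤ max ‖u‖ (‖u‖ ^ (p - 1)) := by
    rw [hS, Finset.mul_sum]
    refine IsUltrametricDist.norm_sum_le_of_forall_le_of_nonneg (le_max_of_le_left hu0.le) ?_
    intro k hk
    rw [Finset.mem_Ioo] at hk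
    rw [one_pow, mul_one, ← mul_assoc, ← pow_succ', norm_mul, norm_pow,
      Nat.sub_add_cancel (by omega)]
    refine (mul_le_of_le_one_right (by positivity) (nat_norm_le_one hnorm _)).trans ?_
    rcases le_total ‖u‖ 1 with h | h
    · exact le_max_of_le_left (pow_le_of_le_one hu0.le h (by omega))
    · exact le_max_of_le_right (pow_le_pow_right₀ h (by omega))
  have hrest : ‖(p : K) * S‖ < ‖u‖ ^ p := by
    rw [norm_mul, p_norm_eq hnorm]
    have hpi : 0 < (p : ℝ)⁻¹ := by have := hp.pos; positivity
    refine (mul_le_mul_of_nonneg_left hSn hpi.le).trans_lt ?_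
    rcases max_cases ‖u‖ (‖u‖ ^ (p - 1)) with ⟨h, _⟩ | ⟨h, _⟩ <;> rw [h, hpow]
    · exact mul_lt_mul_of_pos_right hpp hu0
    · rw [mul_comm]
      exact mul_lt_mul_of_pos_left hpu (by positivity)
  have h1 : u ^ p = (t ^ p - 1) - (p : K) * S := by rw [key]; ring
  have h2 : ‖u ^ p‖ < ‖u‖ ^ p := by
    rw [h1]
    refine (us_sub _ _).trans_lt (max_lt ?_ hrest)
    exact ht.trans_lt (pow_lt_pow_left₀ hlt ha0 (by omega))
  rw [norm_pow] at h2
  exact lt_irrefl _ h2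

lemma summable_bound {r : ℝ} (hr0 : 0 ≤ r) (hr : r < 1) :
    Summable (fun k : ℕ => ((k + 1 : ℕ) : ℝ) * r ^ (k + 1)) := by
  have h := summable_pow_mul_geometric_of_norm_lt_one (R := ℝ) 1 (r := r)
    (by rwa [Real.norm_of_nonneg hr0])
  simp only [pow_one] at h
  exact (summable_nat_add_iff 1).2 h

lemma term_bound (hnorm : ∀ x : ℚ_[p], ‖(algebraMap ℚ_[p] K) x‖ = ‖x‖) (c u : K) (hc : ‖c‖ ≤ 1)
    (k : ℕ) : ‖c * u ^ (k + 1) / ((k + 1 : ℕ) : K)‖ ≤ ((k + 1 : ℕ) : ℝ) * ‖u‖ ^ (k + 1) := by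
  rw [norm_div, norm_mul, norm_pow, div_eq_mul_inv, mul_comm]
  refine mul_le_mul (nat_norm_inv_le hnorm _ (by omega)) ?_ (by positivity) (by positivity)
  exact mul_le_of_le_one_left (by positivity) hc

lemma plog_summable [CompleteSpace K] (hnorm : ∀ x : ℚ_[p], ‖(algebraMap ℚ_[p] K) x‖ = ‖x‖)
    (u : K) (hu : ‖u‖ < 1) :
    Summable (fun k : ℕ => (-1) ^ k * u ^ (k + 1) / ((k + 1 : ℕ) : K)) :=
  Summable.of_norm_bounded (summable_bound (norm_nonneg u) hu)
    (fun k => term_bound hnorm _ u (by simp) k)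

lemma choose_tendsto (hnorm : ∀ x : ℚ_[p], ‖(algebraMap ℚ_[p] K) x‖ = ‖x‖) [CharZero K] (j : ℕ) :
    Tendsto (fun m : ℕ => (((p ^ m - 1).choose j : ℕ) : K)) atTop (𝓝 ((-1) ^ j)) := by
  have hp : p.Prime := Fact.out
  have hq : Tendsto (fun m : ℕ => (p : K) ^ m) atTop (𝓝 0) := by
    apply tendsto_pow_atTop_nhds_zero_of_norm_lt_one
    rw [p_norm_eq hnorm]
    exact inv_lt_one_of_one_lt₀ (by exact_mod_cast hp.one_lt)
  induction j with
  | zero => simp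
  | succ j ih =>
    have h := ((hq.div_const ((j + 1 : ℕ) : K)).mul ih).sub ih
    have e : (0 : K) / ((j + 1 : ℕ) : K) * (-1) ^ j - (-1) ^ j = (-1) ^ (j + 1) := by
      rw [pow_succ]; ring
    rw [e] at h
    refine h.congr fun m => ?_
    obtain ⟨q, hq⟩ : ∃ q, p ^ m = q + 1 := ⟨p ^ m - 1, by have := pow_pos hp.pos m; omega⟩
    have hqK : (p : K) ^ m = (q : K) + 1 := by exact_mod_cast hq
    rw [hq, hqK, Nat.add_sub_cancel]
    have h1 : ((q : K) + 1) * (q.choose j : K) = ((q + 1).choose (j + 1) : K) * ((j + 1 : ℕ) : K) := by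
      exact_mod_cast Nat.add_one_mul_choose_eq q j
    have hj : ((j + 1 : ℕ) : K) ≠ 0 := by exact_mod_cast Nat.succ_ne_zero j
    rw [div_mul_eq_mul_div, h1, mul_div_assoc, div_self hj, Nat.choose_succ_succ]
    push_cast
    ring

lemma plog_limit [CompleteSpace K] [CharZero K]
    (hnorm : ∀ x : ℚ_[p], ‖(algebraMap ℚ_[p] K) x‖ = ‖x‖)
    (t : K) (ht : ‖t - 1‖ < 1) :
    Tendsto (fun m : ℕ => (t ^ (p ^ m) - 1) / (p : K) ^ m) atTop (𝓝 (plog t)) := by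
  have hp : p.Prime := Fact.out
  have h := tendsto_tsum_of_dominated_convergence (𝓕 := atTop)
    (f := fun m k : ℕ => (((p ^ m - 1).choose k : ℕ) : K) * (t - 1) ^ (k + 1) / ((k + 1 : ℕ) : K))
    (g := fun k : ℕ => (-1) ^ k * (t - 1) ^ (k + 1) / ((k + 1 : ℕ) : K))
    (summable_bound (norm_nonneg (t - 1)) ht)
    (fun k => ((choose_tendsto hnorm k).mul_const _).div_const _)
    (Eventually.of_forall fun m k => term_bound hnorm _ _ (nat_norm_le_one hnorm _) k)
  refine h.congr fun m => ?_
  obtain ⟨q, hq⟩ : ∃ q, p ^ m = q + 1 := ⟨p ^ m - 1, by have := pow_pos hp.pos m; omega⟩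
  have hqK : (p : K) ^ m = (q : K) + 1 := by exact_mod_cast hq
  have hq0 : (q : K) + 1 ≠ 0 := by exact_mod_cast Nat.succ_ne_zero q
  rw [hq, hqK, Nat.add_sub_cancel, tsum_eq_sum (s := Finset.range (q + 1))]
  · rw [eq_div_iff hq0, Finset.sum_mul]
    have hb := add_pow (t - 1) 1 (q + 1)
    rw [sub_add_cancel, Finset.sum_range_succ'] at hb
    simp only [one_pow, mul_one, pow_zero, Nat.choose_zero_right, Nat.cast_one] at hb
    rw [hb, add_sub_cancel_right]
    refine Finset.sum_congr rfl fun k _ => ?_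
    have h1 : ((q : K) + 1) * (q.choose k : K) = ((q + 1).choose (k + 1) : K) * ((k + 1 : ℕ) : K) := by
      exact_mod_cast Nat.add_one_mul_choose_eq q k
    have hj : ((k + 1 : ℕ) : K) ≠ 0 := by exact_mod_cast Nat.succ_ne_zero k
    rw [div_mul_eq_mul_div, div_eq_iff hj]
    linear_combination (t - 1) ^ (k + 1) * h1
  · intro k hk
    rw [Finset.mem_range, not_lt] at hk
    rw [Nat.choose_eq_zero_of_lt (by omega)]
    simp

lemma plog_pow [CompleteSpace K] [CharZero K]
    (hnorm : ∀ x : ℚ_[p], ‖(algebraMap ℚ_[p] K) x‖ = ‖x‖)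
    (t : K) (n : ℕ) (ht : ‖t - 1‖ < 1) (ht' : ‖t ^ (p ^ n) - 1‖ < 1) :
    plog (t ^ (p ^ n)) = (p : K) ^ n * plog t := by
  have hp : p.Prime := Fact.out
  have hp0 : (p : K) ≠ 0 := by exact_mod_cast hp.ne_zero
  refine tendsto_nhds_unique (plog_limit hnorm _ ht') ?_
  have h := ((tendsto_add_atTop_iff_nat n).2 (plog_limit hnorm t ht)).const_mul ((p : K) ^ n)
  refine h.congr fun m => ?_
  rw [← pow_mul, ← pow_add, add_comm n m, pow_add (p : K)]
  field_simp

lemma pow_sub_bound [IsUltrametricDist K] (u v : K) (r : ℝ) (hu : ‖u‖ ≤ r) (hv : ‖v‖ ≤ r) (k : ℕ) :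
    ‖u ^ (k + 1) - v ^ (k + 1)‖ ≤ ‖u - v‖ * r ^ k := by
  have hr : 0 ≤ r := (norm_nonneg u).trans hu
  induction k with
  | zero => simp
  | succ k ih =>
    have e : u ^ (k + 1 + 1) - v ^ (k + 1 + 1) =
      u * (u ^ (k + 1) - v ^ (k + 1)) + (u - v) * v ^ (k + 1) := by ring
    rw [e]
    refine (IsUltrametricDist.norm_add_le_max _ _).trans (max_le ?_ ?_)
    · rw [norm_mul]
      calc ‖u‖ * ‖u ^ (k + 1) - v ^ (k + 1)‖ ≤ r * (‖u - v‖ * r ^ k) := by gcongr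
        _ = _ := by ring
    · rw [norm_mul, norm_pow]
      gcongr

lemma G_bound (hodd : Odd p) [CompleteSpace K] [IsUltrametricDist K]
    (hnorm : ∀ x : ℚ_[p], ‖(algebraMap ℚ_[p] K) x‖ = ‖x‖)
    (u v : K) (hu : ‖u‖ ≤ (p : ℝ)⁻¹) (hv : ‖v‖ ≤ (p : ℝ)⁻¹) :
    ‖(plog (1 + u) - u) - (plog (1 + v) - v)‖ ≤ (p : ℝ)⁻¹ * ‖u - v‖ := by
  have hp : p.Prime := Fact.out
  have hp0 : (0 : ℝ) < p := by exact_mod_cast hp.pos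
  have hp1 : (p : ℝ)⁻¹ < 1 := inv_lt_one_of_one_lt₀ (by exact_mod_cast hp.one_lt)
  have e : ∀ w : K, ‖w‖ ≤ (p : ℝ)⁻¹ →
      Summable (fun k : ℕ => (-1) ^ (k + 1) * w ^ (k + 1 + 1) / ((k + 1 + 1 : ℕ) : K)) ∧
      plog (1 + w) - w = ∑' k : ℕ, (-1) ^ (k + 1) * w ^ (k + 1 + 1) / ((k + 1 + 1 : ℕ) : K) := by
    intro w hw
    have hs := plog_summable hnorm w (hw.trans_lt hp1)
    have hs1 := (summable_nat_add_iff
      (f := fun k : ℕ => (-1 : K) ^ k * w ^ (k + 1) / ((k + 1 : ℕ) : K)) 1).2 hs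
    refine ⟨hs1, ?_⟩
    rw [plog, add_sub_cancel_left, hs.tsum_eq_zero_add]
    simp
  obtain ⟨su, eu⟩ := e u hu
  obtain ⟨sv, ev⟩ := e v hv
  rw [eu, ev, ← su.tsum_sub sv]
  refine IsUltrametricDist.norm_tsum_le_of_forall_le fun k => ?_
  rw [← sub_div, ← mul_sub, norm_div, norm_mul, norm_pow, norm_neg, norm_one, one_pow, one_mul,
    div_eq_mul_inv, nat_norm_inv hnorm _ (by omega)]
  have h1 := pow_sub_bound u v _ hu hv (k + 1)
  have h2 : (p : ℝ) ^ padicValNat p (k + 1 + 1) ≤ (p : ℝ) ^ k :=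
    pow_le_pow_right₀ (by exact_mod_cast hp.one_le) (val_bound hodd k)
  calc _ ≤ (‖u - v‖ * (p : ℝ)⁻¹ ^ (k + 1)) * (p : ℝ) ^ k := by gcongr
    _ = _ := by
      rw [pow_succ, inv_pow]; field_simp

lemma plog_zero' : plog (1 + 0 : K) = 0 := by
  simp [plog]

lemma plog_p (hodd : Odd p) [CompleteSpace K] [IsUltrametricDist K]
    (hnorm : ∀ x : ℚ_[p], ‖(algebraMap ℚ_[p] K) x‖ = ‖x‖) :
    ‖plog (1 + (p : K))‖ ≤ (p : ℝ)⁻¹ := by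
  have hp : p.Prime := Fact.out
  have hp1 : (p : ℝ)⁻¹ < 1 := inv_lt_one_of_one_lt₀ (by exact_mod_cast hp.one_lt)
  have hpn := p_norm_eq (K := K) hnorm
  have h := G_bound hodd hnorm (p : K) 0 hpn.le (by simp)
  rw [plog_zero', sub_zero, sub_zero, sub_zero, hpn] at h
  have e : plog (1 + (p : K)) = (plog (1 + (p : K)) - p) + p := by ring
  rw [e]
  refine (IsUltrametricDist.norm_add_le_max _ _).trans (max_le (h.trans ?_) hpn.le)
  exact mul_le_of_le_one_left (by positivity) hp1.le

lemma plog_surj (hodd : Odd p) [CompleteSpace K] [IsUltrametricDist K]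
    (hnorm : ∀ x : ℚ_[p], ‖(algebraMap ℚ_[p] K) x‖ = ‖x‖)
    (r : ℝ) (hr : r ≤ (p : ℝ)⁻¹) (z : K) (hz : ‖z‖ ≤ r) :
    ∃ u : K, ‖u‖ ≤ r ∧ plog (1 + u) = z := by
  have hp : p.Prime := Fact.out
  have hp1 : (p : ℝ)⁻¹ < 1 := inv_lt_one_of_one_lt₀ (by exact_mod_cast hp.one_lt)
  have hr0 : 0 ≤ r := (norm_nonneg z).trans hz
  set f : K → K := fun u => z - (plog (1 + u) - u) with hf
  have hmaps : Set.MapsTo f (Metric.closedBall 0 r) (Metric.closedBall 0 r) := by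
    intro u hu
    rw [mem_closedBall_zero_iff] at hu ⊢
    refine (us_sub _ _).trans (max_le hz ?_)
    have h := G_bound hodd hnorm u 0 (hu.trans hr) (by simp)
    rw [plog_zero', sub_zero, sub_zero, sub_zero] at h
    exact h.trans ((mul_le_of_le_one_left (norm_nonneg _) hp1.le).trans hu)
  have hc : ContractingWith (p : NNReal)⁻¹ (hmaps.restrict f _ _) := by
    refine ⟨by exact_mod_cast hp1, LipschitzWith.of_dist_le_mul fun a b => ?_⟩
    have ha := a.2
    have hb := b.2
    rw [mem_closedBall_zero_iff] at ha hb
    have h := G_bound hodd hnorm b.1 a.1 (hb.trans hr) (ha.trans hr)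
    rw [Subtype.dist_eq, Subtype.dist_eq, dist_comm a.1, dist_eq_norm, dist_eq_norm]
    have e : f a.1 - f b.1 = (plog (1 + b.1) - b.1) - (plog (1 + a.1) - a.1) := by
      simp only [hf]; ring
    simpa [e] using h
  obtain ⟨u, hu, hfix, -⟩ := hc.exists_fixedPoint' Metric.isClosed_closedBall.isComplete hmaps
    (Metric.mem_closedBall_self hr0) (edist_ne_top _ _)
  rw [mem_closedBall_zero_iff] at hu
  refine ⟨u, hu, ?_⟩
  have : z - (plog (1 + u) - u) = u := hfix
  linear_combination -this

noncomputable def Rad (p n : ℕ) : ℝ :=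
  (p : ℝ) ^ (-(1 : ℝ) / ((p : ℝ) ^ ((n : ℝ) - 1) * ((p : ℝ) - 1)))

lemma Rad_succ_pow (n : ℕ) : Rad p (n + 1) ^ p = Rad p n := by
  have hp : p.Prime := Fact.out
  have hp0 : (0 : ℝ) < p := by exact_mod_cast hp.pos
  have hp1 : (0 : ℝ) < p - 1 := by
    have : (1 : ℝ) < p := by exact_mod_cast hp.one_lt
    linarith
  unfold Rad
  rw [← Real.rpow_natCast, ← Real.rpow_mul hp0.le]
  congr 1
  push_cast
  rw [show (n : ℝ) + 1 - 1 = (n - 1) + 1 by ring, Real.rpow_add hp0, Real.rpow_one]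
  have := Real.rpow_pos_of_pos hp0 ((n : ℝ) - 1)
  field_simp

lemma Rad_succ_ge (n : ℕ) : (p : ℝ)⁻¹ ≤ Rad p (n + 1) ^ (p - 1) := by
  have hp : p.Prime := Fact.out
  have hp0 : (0 : ℝ) < p := by exact_mod_cast hp.pos
  have hp1' : (1 : ℝ) < p := by exact_mod_cast hp.one_lt
  have hp1 : (0 : ℝ) < p - 1 := by linarith
  unfold Rad
  rw [← Real.rpow_natCast, ← Real.rpow_mul hp0.le, ← Real.rpow_neg_one]
  apply Real.rpow_le_rpow_of_exponent_le hp1'.le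
  rw [Nat.cast_sub hp.one_le]
  push_cast
  rw [show (n : ℝ) + 1 - 1 = n by ring, Real.rpow_natCast]
  have h1 : (1 : ℝ) ≤ (p : ℝ) ^ n := one_le_pow₀ hp1'.le
  have e : -1 / ((p : ℝ) ^ n * (p - 1)) * (p - 1) = - ((p : ℝ) ^ n)⁻¹ := by field_simp
  rw [e, neg_le_neg_iff]
  exact inv_le_one_of_one_le₀ h1

lemma Rad_lt_one (n : ℕ) : Rad p n < 1 := by
  have hp : p.Prime := Fact.out
  have hp0 : (0 : ℝ) < p := by exact_mod_cast hp.pos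
  have hp1' : (1 : ℝ) < p := by exact_mod_cast hp.one_lt
  have hp1 : (0 : ℝ) < p - 1 := by linarith
  apply Real.rpow_lt_one_of_one_lt_of_neg hp1'
  have := Real.rpow_pos_of_pos hp0 ((n : ℝ) - 1)
  rw [neg_div]
  have : 0 < 1 / ((p : ℝ) ^ ((n : ℝ) - 1) * ((p : ℝ) - 1)) := by positivity
  linarith

lemma Rad_zero : Rad p 0 = (p : ℝ) ^ (- (1 / ((p : ℝ) - 1)) - 1) := by
  have hp : p.Prime := Fact.out
  have hp0 : (0 : ℝ) < p := by exact_mod_cast hp.pos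
  have hp1' : (1 : ℝ) < p := by exact_mod_cast hp.one_lt
  have hp1 : (0 : ℝ) < p - 1 := by linarith
  unfold Rad
  congr 1
  rw [Nat.cast_zero, zero_sub, Real.rpow_neg_one]
  field_simp
  ring

lemma Rad_zero_le : Rad p 0 ≤ (p : ℝ)⁻¹ := by
  have hp : p.Prime := Fact.out
  have hp1' : (1 : ℝ) < p := by exact_mod_cast hp.one_lt
  have hp1 : (0 : ℝ) < p - 1 := by linarith
  rw [Rad_zero, ← Real.rpow_neg_one]
  apply Real.rpow_le_rpow_of_exponent_le hp1'.le
  have : 0 < 1 / ((p : ℝ) - 1) := by positivity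
  linarith

lemma root_iter [IsUltrametricDist K]
    (hnorm : ∀ x : ℚ_[p], ‖(algebraMap ℚ_[p] K) x‖ = ‖x‖) (n : ℕ) (t : K)
    (ht : ‖t ^ (p ^ n) - 1‖ ≤ Rad p 0) : ‖t - 1‖ ≤ Rad p n := by
  induction n generalizing t with
  | zero => simpa using ht
  | succ n ih =>
    refine root_bound hnorm (Rad p (n + 1)) (Real.rpow_nonneg (Nat.cast_nonneg _) _) (Rad_succ_ge n) t ?_
    rw [Rad_succ_pow]
    apply ih
    rwa [← pow_mul, ← pow_succ']

end helpers

/-- Surjectivity step in Theorem `quotstructure`: for every `x` with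
`|x| ≤ p^{n - 1/(p-1)}` there is `t` with `|t - 1| ≤ p^{-1/(p^{n-1}(p-1))}` and
`log_p(t) = x · log_p(1+p)`.  Here `K` plays the role of `ℂ_p`: a complete
algebraically closed nonarchimedean field extension of `ℚ_p` whose norm extends
the `p`-adic norm. -/
theorem statement2 (p : ℕ) [Fact p.Prime] (hodd : Odd p)
    {K : Type*} [NormedField K] [CompleteSpace K] [IsAlgClosed K] [Algebra ℚ_[p] K]
    (hnorm : ∀ x : ℚ_[p], ‖(algebraMap ℚ_[p] K) x‖ = ‖x‖)
    (hna : ∀ x y : K, ‖x + y‖ ≤ max ‖x‖ ‖y‖)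
    (n : ℕ) (x : K) (hx : ‖x‖ ≤ (p : ℝ) ^ ((n : ℝ) - 1 / ((p : ℝ) - 1))) :
    ∃ t : K, ‖t - 1‖ ≤ (p : ℝ) ^ (-(1 : ℝ) / ((p : ℝ) ^ ((n : ℝ) - 1) * ((p : ℝ) - 1))) ∧
      plog t = x * plog (1 + (p : K)) := by
  have hp : p.Prime := Fact.out
  have hp0 : (0 : ℝ) < p := by exact_mod_cast hp.pos
  have : IsUltrametricDist K :=
    IsUltrametricDist.isUltrametricDist_of_forall_norm_add_le_max_norm hna
  have : CharZero K := charZero_of_injective_algebraMap (algebraMap ℚ_[p] K).injective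
  have hpK : (p : K) ≠ 0 := by exact_mod_cast hp.ne_zero
  have hz : ‖(p : K) ^ n * (x * plog (1 + (p : K)))‖ ≤ Rad p 0 := by
    rw [norm_mul, norm_mul, norm_pow, p_norm_eq hnorm]
    calc (p : ℝ)⁻¹ ^ n * (‖x‖ * ‖plog (1 + (p : K))‖)
        ≤ (p : ℝ)⁻¹ ^ n * ((p : ℝ) ^ ((n : ℝ) - 1 / ((p : ℝ) - 1)) * (p : ℝ)⁻¹) := by
          gcongr
          exact plog_p hodd hnorm
      _ = Rad p 0 := by
          rw [Rad_zero, Real.rpow_sub_one hp0.ne', sub_eq_add_neg, Real.rpow_add hp0,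
            Real.rpow_natCast, inv_pow]
          field_simp
  obtain ⟨u, hu, hlog⟩ := plog_surj hodd hnorm _ Rad_zero_le _ hz
  obtain ⟨t, ht⟩ := IsAlgClosed.exists_pow_nat_eq (1 + u) (pow_pos hp.pos n)
  have h1 : ‖t ^ (p ^ n) - 1‖ ≤ Rad p 0 := by rwa [ht, add_sub_cancel_left]
  have h2 := root_iter hnorm n t h1
  refine ⟨t, h2, ?_⟩
  have h3 := plog_pow hnorm t n (h2.trans_lt (Rad_lt_one n)) (h1.trans_lt (Rad_lt_one 0))
  rw [ht, hlog] at h3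
  exact (mul_left_cancel₀ (pow_ne_zero n hpK) h3).symm
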